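/- Under the adapted cuspidal-edge setting: if the Gaussian curvature K_{ŴFC} of the focal surface ŴFC_f is non-negative at a point p = (u₀,0) of the u-axis, then the singular curvature satisfies κ_s(u₀) ≤ 0; and if K_{ŴFC} is strictly positive at every point of the u-axis, then κ_s is strictly negative at every point of the u-axis. -/

import Mathlib

noncomputable section

local notation "⟪" x ", " y "⟫" => @inner ℝ _ _ x y

/-- Euclidean 3-space. -/
abbrev E3 : Type := EuclideanSpace ℝ (Fin 3)

/-- The vector in `E3` with coordinates `(a, b, c)`. -/
def e3 (a b c : ℝ) : E3 := (WithLp.equiv 2 (Fin 3 → ℝ)).symm ![a, b, c]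

/-- Cross product on `E3`. -/
def cross3 (a b : E3) : E3 :=
  e3 (a 1 * b 2 - a 2 * b 1) (a 2 * b 0 - a 0 * b 2) (a 0 * b 1 - a 1 * b 0)

/-- Scalar triple product `det(a,b,c)`. -/
def det3 (a b c : E3) : ℝ := ⟪a, cross3 b c⟫

/-- Partial derivative in the `u`-direction. -/
def pu {E : Type*} [NormedAddCommGroup E] [NormedSpace ℝ E] (g : ℝ × ℝ → E) (p : ℝ × ℝ) : E :=
  fderiv ℝ g p (1, 0)

/-- Partial derivative in the `v`-direction. -/
def pv {E : Type*} [NormedAddCommGroup E] [NormedSpace ℝ E] (g : ℝ × ℝ → E) (p : ℝ × ℝ) : E :=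
  fderiv ℝ g p (0, 1)

/-- Signed area density `λ = det(f_u, f_v, ν)`. -/
def lam (f ν : ℝ × ℝ → E3) (p : ℝ × ℝ) : ℝ := det3 (pu f p) (pv f p) (ν p)


/-- `Ẽ = |f_u|²`. -/
def Etil (f : ℝ × ℝ → E3) (p : ℝ × ℝ) : ℝ := ‖pu f p‖ ^ 2

/-- `F̃ = ⟨f_u, h⟩`. -/
def Ftil (f h : ℝ × ℝ → E3) (p : ℝ × ℝ) : ℝ := ⟪pu f p, h p⟫

/-- `G̃ = |h|²`. -/
def Gtil (h : ℝ × ℝ → E3) (p : ℝ × ℝ) : ℝ := ‖h p‖ ^ 2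

/-- `L̃ = −⟨f_u, ν_u⟩`. -/
def Ltil (f ν : ℝ × ℝ → E3) (p : ℝ × ℝ) : ℝ := -⟪pu f p, pu ν p⟫

/-- `M̃ = −⟨h, ν_u⟩`. -/
def Mtil (ν h : ℝ × ℝ → E3) (p : ℝ × ℝ) : ℝ := -⟪h p, pu ν p⟫

/-- `Ñ = −⟨h, ν_v⟩`. -/
def Ntil (ν h : ℝ × ℝ → E3) (p : ℝ × ℝ) : ℝ := -⟪h p, pv ν p⟫

/-- `Ã = ẼÑ − 2vF̃M̃ + vG̃L̃`. -/
def Atil (f ν h : ℝ × ℝ → E3) (p : ℝ × ℝ) : ℝ :=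
  Etil f p * Ntil ν h p - 2 * p.2 * Ftil f h p * Mtil ν h p + p.2 * Gtil h p * Ltil f ν p

/-- `B̃ = √(Ã² − 4v(ẼG̃−F̃²)(L̃Ñ−vM̃²))`. -/
def Btil (f ν h : ℝ × ℝ → E3) (p : ℝ × ℝ) : ℝ :=
  Real.sqrt ((Atil f ν h p) ^ 2 -
    4 * p.2 * (Etil f p * Gtil h p - (Ftil f h p) ^ 2) *
      (Ltil f ν p * Ntil ν h p - p.2 * (Mtil ν h p) ^ 2))

/-- The bounded principal curvature `κ = 2(L̃Ñ−vM̃²)/(Ã+B̃)`. -/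
def kap (f ν h : ℝ × ℝ → E3) (p : ℝ × ℝ) : ℝ :=
  2 * (Ltil f ν p * Ntil ν h p - p.2 * (Mtil ν h p) ^ 2) / (Atil f ν h p + Btil f ν h p)

/-- `κ̂ = (Ã+B̃)/(2|f_u×h|)`, the smooth extension of `λ·κ₁`. -/
def kaphat (f ν h : ℝ × ℝ → E3) (p : ℝ × ℝ) : ℝ :=
  (Atil f ν h p + Btil f ν h p) / (2 * ‖cross3 (pu f p) (h p)‖)

/-- Singular curvature `κ_s` along the u-axis. -/
def kappas (f ν : ℝ × ℝ → E3) (u : ℝ) : ℝ :=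
  det3 (pu f (u, 0)) (pu (pu f) (u, 0)) (ν (u, 0)) / ‖pu f (u, 0)‖ ^ 3

/-- Cuspidal curvature `κ_c` along the u-axis. -/
def kappac (f ν h : ℝ × ℝ → E3) (u : ℝ) : ℝ :=
  2 * Etil f (u, 0) ^ ((3 : ℝ) / 4) * Ntil ν h (u, 0) /
    (Etil f (u, 0) * Gtil h (u, 0) - (Ftil f h (u, 0)) ^ 2) ^ ((3 : ℝ) / 4)

/-- Cusp-directional torsion `κ_t` along the u-axis. -/
def kappat (f ν h : ℝ × ℝ → E3) (u : ℝ) : ℝ :=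
  (Etil f (u, 0) * Mtil ν h (u, 0) - Ftil f h (u, 0) * Ltil f ν (u, 0)) /
    (Etil f (u, 0) * Real.sqrt (Etil f (u, 0) * Gtil h (u, 0) - (Ftil f h (u, 0)) ^ 2))

/-- The focal surface `ŴFC_f = f + (λ/κ̂)ν`. -/
def FChat (f ν h : ℝ × ℝ → E3) (p : ℝ × ℝ) : E3 :=
  f p + (lam f ν p / kaphat f ν h p) • ν p

/-- Coefficient `E` of the first fundamental form of a surface `W`. -/
def surfE (W : ℝ × ℝ → E3) (p : ℝ × ℝ) : ℝ := ‖pu W p‖ ^ 2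

/-- Coefficient `F` of the first fundamental form of a surface `W`. -/
def surfF (W : ℝ × ℝ → E3) (p : ℝ × ℝ) : ℝ := ⟪pu W p, pv W p⟫

/-- Coefficient `G` of the first fundamental form of a surface `W`. -/
def surfG (W : ℝ × ℝ → E3) (p : ℝ × ℝ) : ℝ := ‖pv W p‖ ^ 2

/-- Unit normal `n = (W_u × W_v)/|W_u × W_v|` of a surface `W`. -/
def surfn (W : ℝ × ℝ → E3) (p : ℝ × ℝ) : E3 :=
  ‖cross3 (pu W p) (pv W p)‖⁻¹ • cross3 (pu W p) (pv W p)

/-- Coefficient `L = ⟨W_uu, n⟩` of the second fundamental form. -/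
def surfL (W : ℝ × ℝ → E3) (p : ℝ × ℝ) : ℝ := ⟪pu (pu W) p, surfn W p⟫

/-- Coefficient `M = ⟨W_uv, n⟩` of the second fundamental form. -/
def surfM (W : ℝ × ℝ → E3) (p : ℝ × ℝ) : ℝ := ⟪pv (pu W) p, surfn W p⟫

/-- Coefficient `N = ⟨W_vv, n⟩` of the second fundamental form. -/
def surfN (W : ℝ × ℝ → E3) (p : ℝ × ℝ) : ℝ := ⟪pv (pv W) p, surfn W p⟫

/-- Gaussian curvature of a surface `W`. -/
def gaussK (W : ℝ × ℝ → E3) (p : ℝ × ℝ) : ℝ :=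
  (surfL W p * surfN W p - (surfM W p) ^ 2) /
    (surfE W p * surfG W p - (surfF W p) ^ 2)

/-- Mean curvature of a surface `W` (w.r.t. the unit normal `surfn W`). -/
def meanH (W : ℝ × ℝ → E3) (p : ℝ × ℝ) : ℝ :=
  (surfE W p * surfN W p - 2 * surfF W p * surfM W p + surfG W p * surfL W p) /
    (2 * (surfE W p * surfG W p - (surfF W p) ^ 2))


theorem inner_E3 (a b : E3) : (⟪a, b⟫ : ℝ) = a 0 * b 0 + a 1 * b 1 + a 2 * b 2 := by
  simp [PiLp.inner_apply, Fin.sum_univ_three]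
  ring

@[simp] theorem cross3_zero_coord (a b : E3) : cross3 a b 0 = a 1 * b 2 - a 2 * b 1 := rfl

@[simp] theorem cross3_one_coord (a b : E3) : cross3 a b 1 = a 2 * b 0 - a 0 * b 2 := rfl

@[simp] theorem cross3_two_coord (a b : E3) : cross3 a b 2 = a 0 * b 1 - a 1 * b 0 := rfl

theorem cross3_smul_right (c : ℝ) (a b : E3) : cross3 a (c • b) = c • cross3 a b := by
  ext i; fin_cases i <;> simp <;> ring

theorem inner_right_cross3_self (a b : E3) : (⟪b, cross3 a b⟫ : ℝ) = 0 := by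
  simp only [inner_E3, cross3_zero_coord, cross3_one_coord, cross3_two_coord]; ring

/-- The triple vector product identity `a × (a × b) = ⟨a, b⟩ a - |a|² b`, paired with `w`. -/
theorem inner_cross3_cross3 (w a b : E3) :
    (⟪w, cross3 a (cross3 a b)⟫ : ℝ) = ⟪a, b⟫ * ⟪a, w⟫ - ‖a‖ ^ 2 * ⟪b, w⟫ := by
  rw [← real_inner_self_eq_norm_sq]
  simp only [inner_E3, cross3_zero_coord, cross3_one_coord, cross3_two_coord]; ring

theorem norm_cross3_sq (a b : E3) :
    ‖cross3 a b‖ ^ 2 = ‖a‖ ^ 2 * ‖b‖ ^ 2 - (⟪a, b⟫ : ℝ) ^ 2 := by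
  simp only [← real_inner_self_eq_norm_sq, inner_E3, cross3_zero_coord, cross3_one_coord,
    cross3_two_coord]
  ring

theorem det3_swap (a b c : E3) : det3 b a c = -det3 a b c := by
  simp only [det3, inner_E3, cross3_zero_coord, cross3_one_coord, cross3_two_coord]; ring

section PartialDerivatives

variable {E : Type*} [NormedAddCommGroup E] [NormedSpace ℝ E]

theorem contDiffAt_pu {g : ℝ × ℝ → E} {p : ℝ × ℝ} (hg : ContDiffAt ℝ (⊤ : ℕ∞) g p) :
    ContDiffAt ℝ (⊤ : ℕ∞) (pu g) p :=
  (hg.fderiv_right (m := (⊤ : ℕ∞)) le_rfl).clm_apply contDiffAt_const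

theorem contDiffAt_pv {g : ℝ × ℝ → E} {p : ℝ × ℝ} (hg : ContDiffAt ℝ (⊤ : ℕ∞) g p) :
    ContDiffAt ℝ (⊤ : ℕ∞) (pv g) p :=
  (hg.fderiv_right (m := (⊤ : ℕ∞)) le_rfl).clm_apply contDiffAt_const

theorem pu_congr {g k : ℝ × ℝ → E} {p : ℝ × ℝ} (hgk : g =ᶠ[nhds p] k) :
    pu g =ᶠ[nhds p] pu k := by
  filter_upwards [hgk.fderiv (𝕜 := ℝ)] with q hq
  simp only [pu, hq]

theorem pv_congr {g k : ℝ × ℝ → E} {p : ℝ × ℝ} (hgk : g =ᶠ[nhds p] k) :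
    pv g =ᶠ[nhds p] pv k := by
  filter_upwards [hgk.fderiv (𝕜 := ℝ)] with q hq
  simp only [pv, hq]

theorem pu_add {g k : ℝ × ℝ → E} {p : ℝ × ℝ} (hg : DifferentiableAt ℝ g p)
    (hk : DifferentiableAt ℝ k p) : pu (fun q => g q + k q) p = pu g p + pu k p := by
  simp only [pu, fderiv_fun_add hg hk, add_apply]

theorem pv_add {g k : ℝ × ℝ → E} {p : ℝ × ℝ} (hg : DifferentiableAt ℝ g p)
    (hk : DifferentiableAt ℝ k p) : pv (fun q => g q + k q) p = pv g p + pv k p := by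
  simp only [pv, fderiv_fun_add hg hk, add_apply]

theorem pv_smul {c : ℝ × ℝ → ℝ} {g : ℝ × ℝ → E} {p : ℝ × ℝ} (hc : DifferentiableAt ℝ c p)
    (hg : DifferentiableAt ℝ g p) :
    pv (fun q => c q • g q) p = pv c p • g p + c p • pv g p := by
  simp [pv, fderiv_fun_smul hc hg, add_comm]

theorem pu_snd_smul {g : ℝ × ℝ → E} {p : ℝ × ℝ} (hg : DifferentiableAt ℝ g p) :
    pu (fun q => q.2 • g q) p = p.2 • pu g p := by
  simp [pu, fderiv_fun_smul (𝕜 := ℝ) differentiableAt_snd hg, fderiv_snd]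

theorem pv_snd_smul {g : ℝ × ℝ → E} {p : ℝ × ℝ} (hg : DifferentiableAt ℝ g p) :
    pv (fun q => q.2 • g q) p = g p + p.2 • pv g p := by
  simp [pv, fderiv_fun_smul (𝕜 := ℝ) differentiableAt_snd hg, fderiv_snd, add_comm]

theorem pv_pu_comm {g : ℝ × ℝ → E} {p : ℝ × ℝ} (hg : ContDiffAt ℝ (⊤ : ℕ∞) g p) :
    pv (pu g) p = pu (pv g) p := by
  have hd : DifferentiableAt ℝ (fderiv ℝ g) p :=
    (hg.fderiv_right (m := (⊤ : ℕ∞)) le_rfl).differentiableAt (by simp)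
  have hs : IsSymmSndFDerivAt ℝ g p := hg.isSymmSndFDerivAt (by
    rw [minSmoothness_of_isRCLikeNormedField]
    exact WithTop.coe_le_coe.mpr le_top)
  have h1 : pv (pu g) p = fderiv ℝ (fderiv ℝ g) p (0, 1) (1, 0) := by
    change fderiv ℝ (fun q => fderiv ℝ g q (1, 0)) p (0, 1) = _
    rw [fderiv_clm_apply hd (differentiableAt_const _)]
    simp
  have h2 : pu (pv g) p = fderiv ℝ (fderiv ℝ g) p (1, 0) (0, 1) := by
    change fderiv ℝ (fun q => fderiv ℝ g q (0, 1)) p (1, 0) = _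
    rw [fderiv_clm_apply hd (differentiableAt_const _)]
    simp
  rw [h1, h2, hs.eq]

theorem eventually_differentiableAt {g : ℝ × ℝ → E} {p : ℝ × ℝ}
    (hg : ContDiffAt ℝ (⊤ : ℕ∞) g p) : ∀ᶠ q in nhds p, DifferentiableAt ℝ g q := by
  filter_upwards [(hg.of_le (m := 1) (by simp)).eventually (by simp)] with q hq
  exact hq.differentiableAt (by simp)

/-- The derivatives at a point of the `u`-axis of a surface `f + v m`, where `f_v = v h`. -/
theorem partials_of_add_snd_smul {W f m h : ℝ × ℝ → E} {u : ℝ}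
    (hf : ContDiffAt ℝ (⊤ : ℕ∞) f (u, 0)) (hm : ContDiffAt ℝ (⊤ : ℕ∞) m (u, 0))
    (hh : ContDiffAt ℝ (⊤ : ℕ∞) h (u, 0))
    (hfv : pv f =ᶠ[nhds (u, 0)] fun q => q.2 • h q)
    (hW : W =ᶠ[nhds (u, 0)] fun q => f q + q.2 • m q) :
    pu W (u, 0) = pu f (u, 0) ∧ pv W (u, 0) = m (u, 0) ∧
      pu (pu W) (u, 0) = pu (pu f) (u, 0) ∧
      pv (pv W) (u, 0) = h (u, 0) + (2 : ℝ) • pv m (u, 0) := by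
  have hWu : pu W =ᶠ[nhds (u, 0)] fun q => pu f q + q.2 • pu m q := by
    filter_upwards [pu_congr hW, eventually_differentiableAt hf,
      eventually_differentiableAt hm] with q hq hfq hmq
    rw [hq, pu_add hfq (differentiableAt_snd.fun_smul hmq), pu_snd_smul hmq]
  have hWv : pv W =ᶠ[nhds (u, 0)] fun q => (q.2 • h q + m q) + q.2 • pv m q := by
    filter_upwards [pv_congr hW, eventually_differentiableAt hf,
      eventually_differentiableAt hm, hfv] with q hq hfq hmq hfvq
    rw [hq, pv_add hfq (differentiableAt_snd.fun_smul hmq), pv_snd_smul hmq, hfvq, add_assoc]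
  have dpuf := (contDiffAt_pu hf).differentiableAt (by simp)
  have dpum := (contDiffAt_pu hm).differentiableAt (by simp)
  have dpvm := (contDiffAt_pv hm).differentiableAt (by simp)
  have dm := hm.differentiableAt (by simp)
  have dh := hh.differentiableAt (by simp)
  refine ⟨by simp [hWu.eq_of_nhds], by simp [hWv.eq_of_nhds], ?_, ?_⟩
  · rw [(pu_congr hWu).eq_of_nhds, pu_add dpuf (differentiableAt_snd.fun_smul dpum),
      pu_snd_smul dpum]
    simp
  · rw [(pv_congr hWv).eq_of_nhds,
      pv_add ((differentiableAt_snd.fun_smul dh).fun_add dm) (differentiableAt_snd.fun_smul dpvm),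
      pv_add (differentiableAt_snd.fun_smul dh) dm, pv_snd_smul dpvm, pv_snd_smul dh]
    simp [two_smul, add_assoc]

end PartialDerivatives

theorem inner_pv_add_pv_inner {a b : ℝ × ℝ → E3} {p : ℝ × ℝ}
    (ha : ContDiffAt ℝ (⊤ : ℕ∞) a p) (hb : ContDiffAt ℝ (⊤ : ℕ∞) b p)
    (hab : (fun q => (⟪a q, b q⟫ : ℝ)) =ᶠ[nhds p] fun _ => 0) :
    (⟪a p, pv b p⟫ : ℝ) + ⟪pv a p, b p⟫ = 0 := by
  have h1 := (pv_congr hab).eq_of_nhds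
  rw [pv, fderiv_inner_apply ℝ (ha.differentiableAt (by simp))
    (hb.differentiableAt (by simp))] at h1
  simpa [pv] using h1

/-- The factor `ρ` in `λ / κ̂ = v ρ`. -/
def focalFactor (f ν h : ℝ × ℝ → E3) (p : ℝ × ℝ) : ℝ :=
  2 * ‖cross3 (pu f p) (h p)‖ ^ 2 / (Atil f ν h p + Btil f ν h p)

theorem contDiffAt_focalFactor {f ν h : ℝ × ℝ → E3} {u : ℝ}
    (hf : ContDiffAt ℝ (⊤ : ℕ∞) f (u, 0)) (hν : ContDiffAt ℝ (⊤ : ℕ∞) ν (u, 0))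
    (hh : ContDiffAt ℝ (⊤ : ℕ∞) h (u, 0)) (hA : 0 < Atil f ν h (u, 0)) :
    ContDiffAt ℝ (⊤ : ℕ∞) (focalFactor f ν h) (u, 0) := by
  have hfu := contDiffAt_pu hf
  have hνu := contDiffAt_pu hν
  have hνv := contDiffAt_pv hν
  have hE : ContDiffAt ℝ (⊤ : ℕ∞) (Etil f) (u, 0) := hfu.norm_sq ℝ
  have hF : ContDiffAt ℝ (⊤ : ℕ∞) (Ftil f h) (u, 0) := hfu.inner ℝ hh
  have hG : ContDiffAt ℝ (⊤ : ℕ∞) (Gtil h) (u, 0) := hh.norm_sq ℝ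
  have hL : ContDiffAt ℝ (⊤ : ℕ∞) (Ltil f ν) (u, 0) := (hfu.inner ℝ hνu).neg
  have hM : ContDiffAt ℝ (⊤ : ℕ∞) (Mtil ν h) (u, 0) := (hh.inner ℝ hνu).neg
  have hN : ContDiffAt ℝ (⊤ : ℕ∞) (Ntil ν h) (u, 0) := (hh.inner ℝ hνv).neg
  have hsnd : ContDiffAt ℝ (⊤ : ℕ∞) (fun q : ℝ × ℝ => q.2) (u, 0) := contDiffAt_snd
  have hAs : ContDiffAt ℝ (⊤ : ℕ∞) (Atil f ν h) (u, 0) :=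
    ((hE.mul hN).sub (((contDiffAt_const.mul hsnd).mul hF).mul hM)).add ((hsnd.mul hG).mul hL)
  have hBs : ContDiffAt ℝ (⊤ : ℕ∞) (Btil f ν h) (u, 0) := by
    refine ContDiffAt.sqrt ((hAs.pow 2).sub
      (((contDiffAt_const.mul hsnd).mul ((hE.mul hG).sub (hF.pow 2))).mul
        ((hL.mul hN).sub (hsnd.mul (hM.pow 2))))) ?_
    simp [hA.ne']
  have hS : ContDiffAt ℝ (⊤ : ℕ∞) (fun q => 2 * ‖cross3 (pu f q) (h q)‖ ^ 2) (u, 0) := by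
    simp only [norm_cross3_sq]
    exact contDiffAt_const.mul ((hE.mul hG).sub (hF.pow 2))
  refine hS.div (hAs.add hBs) ?_
  exact (add_pos_of_pos_of_nonneg hA (Real.sqrt_nonneg _)).ne'

theorem focalFactor_axis {f ν h : ℝ × ℝ → E3} {u : ℝ} (hA : 0 < Atil f ν h (u, 0)) :
    focalFactor f ν h (u, 0) =
      ‖cross3 (pu f (u, 0)) (h (u, 0))‖ ^ 2 / (‖pu f (u, 0)‖ ^ 2 * Ntil ν h (u, 0)) := by
  have hB : Btil f ν h (u, 0) = Atil f ν h (u, 0) := by simp [Btil, Real.sqrt_sq hA.le]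
  have hAv : Atil f ν h (u, 0) = ‖pu f (u, 0)‖ ^ 2 * Ntil ν h (u, 0) := by simp [Atil, Etil]
  rw [focalFactor, hB, ← two_mul, mul_div_mul_left _ _ two_ne_zero, hAv]

/-- If `ν` is the unit normal `(f_u × h) / |f_u × h|` and `f_v = v h`, then
`ŴFC_f = f + v ρ ν`. -/
theorem FChat_eq {f ν h : ℝ × ℝ → E3} {p : ℝ × ℝ} (hfv : pv f p = p.2 • h p)
    (hν : ν p = ‖cross3 (pu f p) (h p)‖⁻¹ • cross3 (pu f p) (h p)) :
    FChat f ν h p = f p + p.2 • (focalFactor f ν h p • ν p) := by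
  have hl : lam f ν p = p.2 * ‖cross3 (pu f p) (h p)‖ := by
    have h1 : lam f ν p = p.2 * (‖cross3 (pu f p) (h p)‖⁻¹ * ‖cross3 (pu f p) (h p)‖ ^ 2) := by
      rw [lam, det3, hfv, hν, ← real_inner_self_eq_norm_sq]
      simp only [inner_E3, cross3_zero_coord, cross3_one_coord, cross3_two_coord,
        PiLp.smul_apply, smul_eq_mul]
      ring
    rw [h1]
    rcases eq_or_ne ‖cross3 (pu f p) (h p)‖ 0 with h0 | h0
    · simp [h0]
    · field_simp
  rw [FChat, hl, kaphat, focalFactor, smul_smul, div_div_eq_mul_div]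
  congr 2
  ring

/-- With `S = a × h`, `ν = S / |S|`, `n = -⟨h, w⟩ > 0` and `w ⊥ a`, the vector
`h + 2 (r ν + ρ w)` has a positive component along `a × ν`, where `ρ = |S|² / (|a|² n)`. -/
theorem inner_cross3_normal {a h ν w : E3} {r : ℝ} (hS : 0 < ‖cross3 a h‖)
    (hν : ν = ‖cross3 a h‖⁻¹ • cross3 a h) (haw : (⟪a, w⟫ : ℝ) = 0) (ha : 0 < ‖a‖)
    (hn : 0 < -(⟪h, w⟫ : ℝ)) :
    (⟪h + (2 : ℝ) • (r • ν + (‖cross3 a h‖ ^ 2 / (‖a‖ ^ 2 * -⟪h, w⟫)) • w),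
      cross3 a ν⟫ : ℝ) = ‖cross3 a h‖ := by
  have hνν := inner_right_cross3_self a ν
  have hhν : (⟪h, cross3 a ν⟫ : ℝ) = -‖cross3 a h‖ := by
    rw [hν, cross3_smul_right, real_inner_smul_right, inner_cross3_cross3,
      real_inner_self_eq_norm_sq, ← pow_two]
    have := norm_cross3_sq a h
    rw [inv_mul_eq_iff_eq_mul₀ hS.ne']
    linarith
  have hwν : (⟪w, cross3 a ν⟫ : ℝ) = ‖cross3 a h‖⁻¹ * (‖a‖ ^ 2 * -⟪h, w⟫) := by
    rw [hν, cross3_smul_right, real_inner_smul_right, inner_cross3_cross3, haw]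
    ring
  rw [inner_add_left, real_inner_smul_left, inner_add_left, real_inner_smul_left,
    real_inner_smul_left, hνν, hhν, hwν]
  generalize -(⟪h, w⟫ : ℝ) = n at hn
  field_simp
  ring

/-- At a point of the `u`-axis the Gaussian curvature of the focal surface is bounded above
by a negative multiple of `κ_s`. -/
theorem exists_gaussK_FChat_le_neg_mul_kappas {U : Set (ℝ × ℝ)} (hU : IsOpen U) {f ν h : ℝ × ℝ → E3}
    (hf : ContDiffOn ℝ (⊤ : ℕ∞) f U) (hν : ContDiffOn ℝ (⊤ : ℕ∞) ν U)
    (hh : ContDiffOn ℝ (⊤ : ℕ∞) h U) (hν1 : ∀ p ∈ U, ‖ν p‖ = 1)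
    (ho : ∀ p ∈ U, (⟪pu f p, ν p⟫ : ℝ) = 0)
    (hfv : ∀ p ∈ U, pv f p = p.2 • h p)
    (hνdef : ∀ p ∈ U, ν p = ‖cross3 (pu f p) (h p)‖⁻¹ • cross3 (pu f p) (h p))
    (hNpos : ∀ p ∈ U, p.2 = 0 → 0 < Ntil ν h p) {u : ℝ} (hu : ((u, 0) : ℝ × ℝ) ∈ U) :
    ∃ c : ℝ, 0 < c ∧ gaussK (FChat f ν h) (u, 0) ≤ -(c * kappas f ν u) := by
  have hUn := hU.mem_nhds hu
  have cf := hf.contDiffAt hUn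
  have cν := hν.contDiffAt hUn
  have ch := hh.contDiffAt hUn
  have hn : 0 < -(⟪h (u, 0), pv ν (u, 0)⟫ : ℝ) := hNpos _ hu rfl
  have hS : 0 < ‖cross3 (pu f (u, 0)) (h (u, 0))‖ := by
    refine lt_of_le_of_ne (norm_nonneg _) fun h0 => ?_
    have h1 := hν1 _ hu
    rw [hνdef _ hu, ← h0] at h1
    simp at h1
  have ha : 0 < ‖pu f (u, 0)‖ := by
    refine lt_of_le_of_ne (norm_nonneg _) fun h0 => ?_
    have h1 := norm_cross3_sq (pu f (u, 0)) (h (u, 0))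
    rw [← h0] at h1
    nlinarith [sq_nonneg (⟪pu f (u, 0), h (u, 0)⟫ : ℝ), pow_pos hS 2]
  have hA : 0 < Atil f ν h (u, 0) := by
    simpa [Atil, Etil] using mul_pos (pow_pos ha 2) (hNpos _ hu rfl)
  have cρ := contDiffAt_focalFactor cf cν ch hA
  have hρ := focalFactor_axis hA
  have hρpos : 0 < focalFactor f ν h (u, 0) := by
    rw [hρ]
    exact div_pos (pow_pos hS 2) (mul_pos (pow_pos ha 2) (hNpos _ hu rfl))
  have hfv' : pv f =ᶠ[nhds (u, 0)] fun q => q.2 • h q := by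
    filter_upwards [hUn] with q hq using hfv q hq
  have hW : FChat f ν h =ᶠ[nhds (u, 0)]
      fun q => f q + q.2 • (focalFactor f ν h q • ν q) := by
    filter_upwards [hUn] with q hq using FChat_eq (hfv q hq) (hνdef q hq)
  obtain ⟨hWu, hWv, hWuu, hWvv⟩ :=
    partials_of_add_snd_smul cf (cρ.fun_smul cν) ch hfv' hW
  have hpv : pv (fun q => focalFactor f ν h q • ν q) (u, 0) = _ :=
    pv_smul (cρ.differentiableAt (by simp)) (cν.differentiableAt (by simp))
  have hfuν : (⟪pu f (u, 0), pv ν (u, 0)⟫ : ℝ) = 0 := by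
    have h1 := inner_pv_add_pv_inner (contDiffAt_pu cf) cν (by
      filter_upwards [hUn] with q hq using ho q hq)
    rw [pv_pu_comm cf, (pu_congr hfv').eq_of_nhds,
      pu_snd_smul (ch.differentiableAt (by simp))] at h1
    simpa using h1
  have hvv := inner_cross3_normal (r := pv (focalFactor f ν h) (u, 0)) hS (hνdef _ hu) hfuν ha hn
  have hνu := hν1 _ hu
  have hdet := det3_swap (pu f (u, 0)) (pu (pu f) (u, 0)) (ν (u, 0))
  have horth := ho _ hu
  change focalFactor f ν h (u, 0) = _ / (_ * -⟪h (u, 0), pv ν (u, 0)⟫) at hρ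
  rw [← hρ, ← hpv, ← hWvv] at hvv
  rw [det3] at hdet
  have hX : 0 < ‖cross3 (pu f (u, 0)) (focalFactor f ν h (u, 0) • ν (u, 0))‖ := by
    rw [norm_pos_iff, cross3_smul_right]
    refine smul_ne_zero hρpos.ne' fun h0 => ?_
    rw [h0, inner_zero_right] at hvv
    exact hS.ne hvv
  have hD : surfE (FChat f ν h) (u, 0) * surfG (FChat f ν h) (u, 0)
      - surfF (FChat f ν h) (u, 0) ^ 2 = (‖pu f (u, 0)‖ * focalFactor f ν h (u, 0)) ^ 2 := by
    rw [surfE, surfF, surfG, hWu, hWv, real_inner_smul_right, horth, norm_smul, hνu,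
      Real.norm_of_nonneg hρpos.le]
    ring
  have hn' : surfn (FChat f ν h) (u, 0) =
      (‖cross3 (pu f (u, 0)) (focalFactor f ν h (u, 0) • ν (u, 0))‖⁻¹ *
        focalFactor f ν h (u, 0)) • cross3 (pu f (u, 0)) (ν (u, 0)) := by
    rw [surfn, hWu, hWv, cross3_smul_right, smul_smul]
  set s := ‖cross3 (pu f (u, 0)) (focalFactor f ν h (u, 0) • ν (u, 0))‖⁻¹ *
        focalFactor f ν h (u, 0)
  have hs : 0 < s := mul_pos (inv_pos.mpr hX) hρpos
  have hLk : surfL (FChat f ν h) (u, 0) = -(s * ‖pu f (u, 0)‖ ^ 3 * kappas f ν u) := by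
    rw [surfL, hn', real_inner_smul_right, hWuu, hdet, kappas]
    field_simp
  have hNk : surfN (FChat f ν h) (u, 0) = s * ‖cross3 (pu f (u, 0)) (h (u, 0))‖ := by
    rw [surfN, hn', real_inner_smul_right, hvv]
  refine ⟨s * ‖pu f (u, 0)‖ ^ 3 * (s * ‖cross3 (pu f (u, 0)) (h (u, 0))‖) /
    (‖pu f (u, 0)‖ * focalFactor f ν h (u, 0)) ^ 2, by positivity, ?_⟩
  rw [gaussK, hD, hLk, hNk, div_mul_eq_mul_div, ← neg_div]
  gcongr
  nlinarith [sq_nonneg (surfM (FChat f ν h) (u, 0))]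

/-- if the Gaussian curvature of the focal surface `ŴFC_f` is non-negative at
`(u₀,0)`, then `κ_s(u₀) ≤ 0`; if it is strictly positive along the u-axis, then `κ_s < 0`
along the u-axis. -/
theorem stmt16
    (U : Set (ℝ × ℝ)) (hU : IsOpen U)
    (f ν h : ℝ × ℝ → E3)
    (hf : ContDiffOn ℝ (⊤ : ℕ∞) f U) (hν : ContDiffOn ℝ (⊤ : ℕ∞) ν U) (hhsm : ContDiffOn ℝ (⊤ : ℕ∞) h U)
    (hax : ∃ p ∈ U, p.2 = (0 : ℝ))
    (hν1 : ∀ p ∈ U, ‖ν p‖ = 1)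
    (ho1 : ∀ p ∈ U, (⟪pu f p, ν p⟫ : ℝ) = 0)
    (ho2 : ∀ p ∈ U, (⟪pv f p, ν p⟫ : ℝ) = 0)
    (hfront : ∀ p ∈ U, Function.Injective ⇑(fderiv ℝ (fun q => (f q, ν q)) p))
    (hlam : ∀ p ∈ U, (lam f ν p = 0 ↔ p.2 = 0))
    (hh0 : ∀ p ∈ U, h p ≠ 0)
    (hfv : ∀ p ∈ U, pv f p = p.2 • h p)
    (hνdef : ∀ p ∈ U, ν p = ‖cross3 (pu f p) (h p)‖⁻¹ • cross3 (pu f p) (h p))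
    (hNpos : ∀ p ∈ U, p.2 = 0 → 0 < Ntil ν h p) :
    (∀ u₀ : ℝ, ((u₀, 0) : ℝ × ℝ) ∈ U →
      0 ≤ gaussK (FChat f ν h) (u₀, 0) → kappas f ν u₀ ≤ 0) ∧
    ((∀ u : ℝ, ((u, 0) : ℝ × ℝ) ∈ U → 0 < gaussK (FChat f ν h) (u, 0)) →
      ∀ u : ℝ, ((u, 0) : ℝ × ℝ) ∈ U → kappas f ν u < 0) := by
  have key := fun u hu => exists_gaussK_FChat_le_neg_mul_kappas hU hf hν hhsm hν1 ho1 hfv hνdef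
    hNpos (u := u) hu
  refine ⟨fun u hu hK => ?_, fun hK u hu => ?_⟩
  · obtain ⟨c, hc, hle⟩ := key u hu
    nlinarith
  · obtain ⟨c, hc, hle⟩ := key u hu
    have := hK u hu
    nlinarith
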